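/- arXiv:2006.11128 — 2 statements merged into one kernel-verified Lean document; each statement's English description precedes it below -/
import Mathlib

section
/- Let D be a bounded linear operator on L²(𝕋^d) and suppose there exist N ∈ ℕ, constants 0 < β⁻ ≤ β⁺ < ∞ and a measurable kernel β_N : 𝕋^d × 𝕋^d → ℝ with β⁻ ≤ β_N(x,y) ≤ β⁺ for all x,y, such that D^N v(x) = ∫_{𝕋^d} β_N(x,y) v(y) dy for every v ∈ L²(𝕋^d). If u ∈ L²(𝕋^d) satisfies D u = u, u ≥ 0 almost everywhere and u is not almost everywhere zero, then there exist constants c⁻ > 0 and c⁺ < ∞ such that c⁻ ≤ u(x) ≤ c⁺ for almost every x ∈ 𝕋^d; one may take c⁻ = β⁻ ∫_{𝕋^d} u and c⁺ = β⁺ ∫_{𝕋^d} u. -/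
open MeasureTheory

/-- A kernel operator with kernel bounded between `a` and `b` maps a nonnegative integrable
function `f` to a function with values between `a * ∫ f` and `b * ∫ f`. -/
theorem integral_kernel_mul_mem_Icc {α : Type*} [MeasurableSpace α] {μ : Measure α}
    {k f : α → ℝ} {a b : ℝ} (hk : Measurable k) (hab : ∀ y, k y ∈ Set.Icc a b)
    (hf : Integrable f μ) (hf0 : 0 ≤ᵐ[μ] f) :
    ∫ y, k y * f y ∂μ ∈ Set.Icc (a * ∫ y, f y ∂μ) (b * ∫ y, f y ∂μ) := by
  have hkf : Integrable (fun y => k y * f y) μ :=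
    hf.bdd_mul (c := max |a| |b|) hk.aestronglyMeasurable
      (.of_forall fun y => abs_le_max_abs_abs (hab y).1 (hab y).2)
  constructor
  · rw [← integral_const_mul]
    refine integral_mono_ae (hf.const_mul a) hkf ?_
    filter_upwards [hf0] with y hy using mul_le_mul_of_nonneg_right (hab y).1 hy
  · rw [← integral_const_mul]
    refine integral_mono_ae hkf (hf.const_mul b) ?_
    filter_upwards [hf0] with y hy using mul_le_mul_of_nonneg_right (hab y).2 hy

/-- Two-sided bounds for a nonnegative fixed point: if some power `D^N`
of the bounded operator `D` on `L²(𝕋^d)` is an integral operator with kernel `β_N`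
satisfying `0 < β⁻ ≤ β_N ≤ β⁺`, and `u ≥ 0`, `u ≠ 0` satisfies `D u = u`, then
`β⁻ ∫ u ≤ u(x) ≤ β⁺ ∫ u` almost everywhere (and `β⁻ ∫ u > 0`). -/
theorem stmt13 (d : ℕ) (hd : 1 ≤ d)
    (D : Lp ℝ 2 (volume : Measure (Fin d → AddCircle (1 : ℝ))) →L[ℝ]
      Lp ℝ 2 (volume : Measure (Fin d → AddCircle (1 : ℝ))))
    (N : ℕ)
    (βN : (Fin d → AddCircle (1 : ℝ)) → (Fin d → AddCircle (1 : ℝ)) → ℝ)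
    (hβmeas : Measurable (Function.uncurry βN))
    (βm βM : ℝ) (hβm : 0 < βm)
    (hβbound : ∀ x y, βm ≤ βN x y ∧ βN x y ≤ βM)
    (hDN : ∀ v : Lp ℝ 2 (volume : Measure (Fin d → AddCircle (1 : ℝ))),
      ∀ᵐ x ∂(volume : Measure (Fin d → AddCircle (1 : ℝ))),
        ((D ^ N) v : (Fin d → AddCircle (1 : ℝ)) → ℝ) x
          = ∫ y, βN x y * (v : (Fin d → AddCircle (1 : ℝ)) → ℝ) y)
    (u : Lp ℝ 2 (volume : Measure (Fin d → AddCircle (1 : ℝ))))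
    (hfix : D u = u)
    (hu_nonneg : ∀ᵐ x ∂(volume : Measure (Fin d → AddCircle (1 : ℝ))),
      0 ≤ (u : (Fin d → AddCircle (1 : ℝ)) → ℝ) x)
    (hu_ne : u ≠ 0) :
    0 < βm * ∫ x, (u : (Fin d → AddCircle (1 : ℝ)) → ℝ) x ∧
    ∀ᵐ x ∂(volume : Measure (Fin d → AddCircle (1 : ℝ))),
      βm * (∫ y, (u : (Fin d → AddCircle (1 : ℝ)) → ℝ) y)
          ≤ (u : (Fin d → AddCircle (1 : ℝ)) → ℝ) x ∧
        (u : (Fin d → AddCircle (1 : ℝ)) → ℝ) x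
          ≤ βM * ∫ y, (u : (Fin d → AddCircle (1 : ℝ)) → ℝ) y := by
  have hint : Integrable u volume := (Lp.memLp u).integrable one_le_two
  have hpow : (D ^ N) u = u := by
    rw [FunLike.coe_pow_eq_iterate]
    exact Function.iterate_fixed hfix N
  refine ⟨mul_pos hβm ((integral_nonneg_of_ae hu_nonneg).lt_of_ne' fun h => hu_ne ?_), ?_⟩
  · exact (Lp.eq_zero_iff_ae_eq_zero).2 ((integral_eq_zero_iff_of_nonneg_ae hu_nonneg hint).1 h)
  · have hu := hDN u
    rw [hpow] at hu
    filter_upwards [hu] with x hx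
    rw [hx]
    exact integral_kernel_mul_mem_Icc (hβmeas.comp measurable_prodMk_left) (hβbound x)
      hint hu_nonneg
end

section
/- Let L : ℝ^d → [0,∞) be convex with L(ζ)/|ζ| → +∞ as |ζ| → ∞. Fix T > 0, x ∈ ℝ^d and s ≥ 0. Then the set of all γ ∈ C([0,T]; ℝ^d) such that γ(0) = x, γ is absolutely continuous (i.e. there exists v ∈ L¹([0,T]; ℝ^d) with γ(t) = x + ∫₀ᵗ v(r) dr for all t ∈ [0,T]) and ∫₀ᵀ L(v(r)) dr ≤ s, is a compact subset of C([0,T]; ℝ^d) equipped with the supremum norm. -/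
open MeasureTheory Filter

open Set Topology AbsolutelyContinuousOnInterval

lemma exists_norm_le_add_mul_of_superlinear {E : Type*} [NormedAddCommGroup E] {L : E → ℝ}
    (hL0 : ∀ ζ, 0 ≤ L ζ)
    (hLs : Tendsto (fun ζ : E => L ζ / ‖ζ‖) (comap norm atTop) atTop) {c : ℝ} (hc : 0 < c) :
    ∃ R, 0 ≤ R ∧ ∀ ζ, ‖ζ‖ ≤ R + c * L ζ := by
  have h := hLs.eventually_ge_atTop c⁻¹
  rw [eventually_comap, eventually_atTop] at h
  obtain ⟨R, hR⟩ := h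
  refine ⟨max R 0, le_max_right _ _, fun ζ => ?_⟩
  have hcL : 0 ≤ c * L ζ := mul_nonneg hc.le (hL0 ζ)
  rcases le_or_gt ‖ζ‖ (max R 0) with h | h
  · linarith
  · have hζ : 0 < ‖ζ‖ := (le_max_right _ _).trans_lt h
    have := hR ‖ζ‖ ((le_max_left _ _).trans h.le) ζ rfl
    rw [le_div_iff₀ hζ, inv_mul_le_iff₀ hc] at this
    linarith [le_max_right R 0]

lemma exists_modulus_of_superlinear {E : Type*} [NormedAddCommGroup E] {L : E → ℝ}
    (hL0 : ∀ ζ, 0 ≤ L ζ)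
    (hLs : Tendsto (fun ζ : E => L ζ / ‖ζ‖) (comap norm atTop) atTop) {s ε : ℝ}
    (hs : 0 ≤ s) (hε : 0 < ε) :
    ∃ R c δ, 0 ≤ c ∧ (∀ ζ, ‖ζ‖ ≤ R + c * L ζ) ∧ 0 < δ ∧ ∀ r < δ, R * r + c * s < ε := by
  obtain ⟨R, hR0, hR⟩ := exists_norm_le_add_mul_of_superlinear hL0 hLs
    (c := ε / (2 * (s + 1))) (by positivity)
  refine ⟨R, _, ε / (2 * (R + 1)), by positivity, hR, by positivity, fun r hr => ?_⟩
  have h1 : ε / (2 * (s + 1)) * s < ε / 2 := by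
    rw [div_mul_eq_mul_div, div_lt_div_iff₀ (by positivity) (by positivity)]
    nlinarith
  have h2 : R * r ≤ ε / 2 :=
    calc R * r ≤ R * (ε / (2 * (R + 1))) := by gcongr
      _ ≤ ε / 2 := by
        rw [mul_div_assoc', div_le_div_iff₀ (by positivity) (by positivity)]
        nlinarith
  linarith

section ActionCurves

variable {E : Type*} [NormedAddCommGroup E] [NormedSpace ℝ E]

/-- `F` is a primitive on `[0, T]` of the integrable velocity `w`, whose `L`-action is at
most `s`. -/
structure IsActionCurve (L : E → ℝ) (T s : ℝ) (F w : ℝ → E) : Prop where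
  stronglyMeasurable : StronglyMeasurable w
  integrableOn : IntegrableOn w (Icc 0 T)
  sub_eq : ∀ a ∈ Icc 0 T, ∀ b ∈ Icc 0 T, F b - F a = ∫ r in a..b, w r
  lintegral_le : ∫⁻ r in Icc 0 T, ENNReal.ofReal (L (w r)) ≤ ENNReal.ofReal s

variable {L : E → ℝ} {T s : ℝ}

/-- Jensen's inequality on an interval, without integrability of the right-hand side. -/
lemma ConvexOn.ofReal_map_average_le_lintegral [CompleteSpace E] (hL0 : ∀ ζ, 0 ≤ L ζ)
    (hL : ConvexOn ℝ univ L) (hLc : Continuous L) {w : ℝ → E} (hw : StronglyMeasurable w)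
    {a b : ℝ} (hab : a < b) (hi : IntegrableOn w (Ioc a b)) :
    ENNReal.ofReal (L ((b - a)⁻¹ • ∫ r in a..b, w r)) ≤
      ENNReal.ofReal (b - a)⁻¹ * ∫⁻ r in Ioc a b, ENNReal.ofReal (L (w r)) := by
  have hba : 0 < b - a := sub_pos.2 hab
  have hm : StronglyMeasurable (L ∘ w) := hLc.comp_stronglyMeasurable hw
  by_cases htop : ∫⁻ r in Ioc a b, ENNReal.ofReal (L (w r)) = ⊤
  · rw [htop, ENNReal.mul_top (by simpa using hba)]
    exact le_top
  have hLi : IntegrableOn (fun r => L (w r)) (Ioc a b) :=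
    (lintegral_ofReal_ne_top_iff_integrable hm.aestronglyMeasurable
      (Eventually.of_forall fun _ => hL0 _)).1 htop
  have hJ := hL.map_set_average_le (f := w) (μ := volume) (t := Ioc a b) hLc.continuousOn
    isClosed_univ (by simpa using hab) (by simp) (by simp) hi hLi
  rw [setAverage_eq, setAverage_eq, Measure.real, Real.volume_Ioc, ENNReal.toReal_ofReal hba.le]
    at hJ
  rw [← ofReal_integral_eq_lintegral_ofReal hLi (Eventually.of_forall fun _ => hL0 _),
    ← ENNReal.ofReal_mul (by positivity), intervalIntegral.integral_of_le hab.le]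
  exact ENNReal.ofReal_le_ofReal hJ

/-- Averaging over windows of length `h` does not increase the integral. -/
lemma setLIntegral_setLIntegral_Ioc_le {g : ℝ → ENNReal} (hg : Measurable g) (h : ℝ) :
    ∫⁻ t in Icc 0 (T - h), ∫⁻ r in Ioc t (t + h), g r ≤
      ENNReal.ofReal h * ∫⁻ r in Icc 0 T, g r := by
  have hshift : ∀ t, ∫⁻ r in Ioc t (t + h), g r = ∫⁻ u in Ioc 0 h, g (t + u) := fun t => by
    rw [← (measurePreserving_add_left volume t).setLIntegral_comp_preimage measurableSet_Ioc hg]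
    simp
  simp_rw [hshift]
  rw [lintegral_lintegral_swap (by fun_prop)]
  calc ∫⁻ u in Ioc 0 h, ∫⁻ t in Icc 0 (T - h), g (t + u)
      ≤ ∫⁻ _ in Ioc 0 h, ∫⁻ r in Icc 0 T, g r := by
        refine setLIntegral_mono (by fun_prop) fun u hu => ?_
        rw [← (measurePreserving_add_right volume u).setLIntegral_comp_preimage
          measurableSet_Icc hg]
        refine lintegral_mono_set fun t ht => ?_
        simp only [mem_preimage, mem_Icc, mem_Ioc] at *
        constructor <;> linarith
    _ = _ := by simp [mul_comm]

namespace IsActionCurve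

variable {F w : ℝ → E}

lemma lintegral_diffQuotient_le [CompleteSpace E] (hF : IsActionCurve L T s F w)
    (hL0 : ∀ ζ, 0 ≤ L ζ) (hL : ConvexOn ℝ univ L) (hLc : Continuous L) {h : ℝ} (hh : 0 < h) :
    ∫⁻ t in Icc 0 (T - h), ENNReal.ofReal (L (h⁻¹ • (F (t + h) - F t))) ≤ ENNReal.ofReal s := by
  have hm : Measurable fun r => ENNReal.ofReal (L (w r)) :=
    ENNReal.measurable_ofReal.comp (hLc.comp_stronglyMeasurable hF.stronglyMeasurable).measurable
  calc ∫⁻ t in Icc 0 (T - h), ENNReal.ofReal (L (h⁻¹ • (F (t + h) - F t)))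
      ≤ ∫⁻ t in Icc 0 (T - h), ENNReal.ofReal h⁻¹ *
          ∫⁻ r in Ioc t (t + h), ENNReal.ofReal (L (w r)) := by
        refine setLIntegral_mono' measurableSet_Icc fun t ht => ?_
        have ht0 := ht.1
        have htT := ht.2
        rw [hF.sub_eq t ⟨by linarith, by linarith⟩ _ ⟨by linarith, by linarith⟩]
        have := hL.ofReal_map_average_le_lintegral hL0 hLc hF.stronglyMeasurable
          (show t < t + h by linarith) (hF.integrableOn.mono_set fun r hr =>
            ⟨ht0.trans hr.1.le, hr.2.trans (by linarith)⟩)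
        rwa [add_sub_cancel_left] at this
    _ = ENNReal.ofReal h⁻¹ * ∫⁻ t in Icc 0 (T - h), ∫⁻ r in Ioc t (t + h),
          ENNReal.ofReal (L (w r)) := lintegral_const_mul' _ _ ENNReal.ofReal_ne_top
    _ ≤ ENNReal.ofReal h⁻¹ * (ENNReal.ofReal h * ENNReal.ofReal s) := by
        gcongr
        exact (setLIntegral_setLIntegral_Ioc_le hm h).trans (by gcongr; exact hF.lintegral_le)
    _ = ENNReal.ofReal s := by
        rw [← mul_assoc, ← ENNReal.ofReal_mul (by positivity), inv_mul_cancel₀ hh.ne']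
        simp

lemma integrableOn_comp (hF : IsActionCurve L T s F w) (hL0 : ∀ ζ, 0 ≤ L ζ)
    (hLc : Continuous L) : IntegrableOn (fun r => L (w r)) (Icc 0 T) :=
  (lintegral_ofReal_ne_top_iff_integrable
    (hLc.comp_stronglyMeasurable hF.stronglyMeasurable).aestronglyMeasurable
    (Eventually.of_forall fun _ => hL0 _)).1 (hF.lintegral_le.trans_lt ENNReal.ofReal_lt_top).ne

lemma sum_dist_le (hF : IsActionCurve L T s F w) (hL0 : ∀ ζ, 0 ≤ L ζ) (hLc : Continuous L)
    (hT : 0 ≤ T) (hs : 0 ≤ s) {R c : ℝ} (hc : 0 ≤ c) (hRc : ∀ ζ, ‖ζ‖ ≤ R + c * L ζ)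
    {I : ℕ × (ℕ → ℝ × ℝ)} (hI : I ∈ disjWithin 0 T) :
    ∑ i ∈ Finset.range I.1, dist (F (I.2 i).1) (F (I.2 i).2) ≤
      R * ∑ i ∈ Finset.range I.1, dist (I.2 i).1 (I.2 i).2 + c * s := by
  have hsub : ∀ i ∈ Finset.range I.1, uIoc (I.2 i).1 (I.2 i).2 ⊆ Icc 0 T := fun i hi =>
    (uIoc_subset_of_mem_disjWithin (n := I.1) (I := I.2) hI (Finset.mem_range.1 hi)).trans
      (by rw [uIoc_of_le hT]; exact Ioc_subset_Icc_self)
  have hLi := hF.integrableOn_comp hL0 hLc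
  have hterm : ∀ i ∈ Finset.range I.1, dist (F (I.2 i).1) (F (I.2 i).2) ≤
      R * dist (I.2 i).1 (I.2 i).2 + c * ∫ r in uIoc (I.2 i).1 (I.2 i).2, L (w r) := by
    intro i hi
    obtain ⟨h1, h2⟩ := hI.1 i hi
    rw [uIcc_of_le hT] at h1 h2
    rw [dist_comm, dist_eq_norm, hF.sub_eq _ h1 _ h2]
    have hLi' := hLi.mono_set (hsub i hi)
    have : IsFiniteMeasure (volume.restrict (uIoc (I.2 i).1 (I.2 i).2)) := by
      unfold uIoc; infer_instance
    calc ‖∫ r in (I.2 i).1..(I.2 i).2, w r‖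
        ≤ ∫ r in uIoc (I.2 i).1 (I.2 i).2, ‖w r‖ :=
          intervalIntegral.norm_integral_le_integral_norm_uIoc
      _ ≤ ∫ r in uIoc (I.2 i).1 (I.2 i).2, (R + c * L (w r)) :=
          integral_mono (hF.integrableOn.mono_set (hsub i hi)).norm
            ((integrable_const R).add (hLi'.const_mul c)) fun r => hRc _
      _ = _ := by
          rw [integral_add (integrable_const R) (hLi'.const_mul c), integral_const_mul]
          simp [Real.dist_eq, uIoc, mul_comm, max_sub_min_eq_abs, abs_sub_comm, Measure.real]
  have hint : ∑ i ∈ Finset.range I.1, ∫ r in uIoc (I.2 i).1 (I.2 i).2, L (w r) ≤ s := by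
    rw [← integral_biUnion_finset _ (fun i _ => measurableSet_uIoc) hI.2
      fun i hi => hLi.mono_set (hsub i hi)]
    refine (setIntegral_mono_set hLi (Eventually.of_forall fun _ => hL0 _)
      (iUnion₂_subset hsub).eventuallyLE).trans ?_
    rw [← ENNReal.ofReal_le_ofReal_iff hs,
      ofReal_integral_eq_lintegral_ofReal hLi (Eventually.of_forall fun _ => hL0 _)]
    exact hF.lintegral_le
  calc _ ≤ _ := Finset.sum_le_sum hterm
    _ = R * ∑ i ∈ Finset.range I.1, dist (I.2 i).1 (I.2 i).2 +
        c * ∑ i ∈ Finset.range I.1, ∫ r in uIoc (I.2 i).1 (I.2 i).2, L (w r) := by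
      rw [Finset.sum_add_distrib, Finset.mul_sum, Finset.mul_sum]
    _ ≤ _ := by gcongr

lemma dist_le (hF : IsActionCurve L T s F w) (hL0 : ∀ ζ, 0 ≤ L ζ) (hLc : Continuous L)
    (hT : 0 ≤ T) (hs : 0 ≤ s) {R c : ℝ} (hc : 0 ≤ c) (hRc : ∀ ζ, ‖ζ‖ ≤ R + c * L ζ)
    {a b : ℝ} (ha : a ∈ Icc 0 T) (hb : b ∈ Icc 0 T) :
    dist (F a) (F b) ≤ R * dist a b + c * s := by
  have := hF.sum_dist_le hL0 hLc hT hs hc hRc (I := (1, fun _ => (a, b)))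
    ⟨by simp [uIcc_of_le hT, ha.1, ha.2, hb.1, hb.2], by simp⟩
  simpa using this

end IsActionCurve

lemma lintegral_le_of_tendsto_of_forall_le {α : Type*} [MeasurableSpace α] {μ : Measure α}
    {f : ℕ → α → ENNReal} {g : α → ENNReal} {C : ENNReal} (hf : ∀ n, AEMeasurable (f n) μ)
    (hlim : ∀ᵐ x ∂μ, Tendsto (fun n => f n x) atTop (𝓝 (g x)))
    (hC : ∀ n, ∫⁻ x, f n x ∂μ ≤ C) : ∫⁻ x, g x ∂μ ≤ C :=
  calc ∫⁻ x, g x ∂μ = ∫⁻ x, liminf (fun n => f n x) atTop ∂μ :=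
        lintegral_congr_ae (hlim.mono fun _ hx => hx.liminf_eq.symm)
    _ ≤ liminf (fun n => ∫⁻ x, f n x ∂μ) atTop := lintegral_liminf_le' hf
    _ ≤ liminf (fun _ : ℕ => C) atTop := liminf_le_liminf (Eventually.of_forall hC)
    _ = C := liminf_const C

/-- Lower semicontinuity of the action, expressed through difference quotients. -/
lemma lintegral_comp_deriv_le_of_diffQuotient (hLc : Continuous L) {G : ℝ → E}
    (hG : Continuous G) (hd : ∀ᵐ t, t ∈ Icc 0 T → DifferentiableAt ℝ G t) {C : ENNReal}
    (hC : ∀ h : ℝ, 0 < h →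
      ∫⁻ t in Icc 0 (T - h), ENNReal.ofReal (L (h⁻¹ • (G (t + h) - G t))) ≤ C) :
    ∫⁻ t in Icc 0 T, ENNReal.ofReal (L (deriv G t)) ≤ C := by
  let h : ℕ → ℝ := fun n => 1 / ((n : ℝ) + 1)
  have hpos : ∀ n, 0 < h n := fun n => Nat.one_div_pos_of_nat
  have hlim : Tendsto h atTop (𝓝 0) := tendsto_one_div_add_atTop_nhds_zero_nat
  have hcont : ∀ n, Continuous fun t =>
      ENNReal.ofReal (L ((h n)⁻¹ • (G (t + h n) - G t))) := fun n =>
    ENNReal.continuous_ofReal.comp (by fun_prop)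
  refine lintegral_le_of_tendsto_of_forall_le
    (f := fun n => (Icc 0 (T - h n)).indicator fun t =>
      ENNReal.ofReal (L ((h n)⁻¹ • (G (t + h n) - G t))))
    (fun n => ((hcont n).measurable.indicator measurableSet_Icc).aemeasurable) ?_ fun n => ?_
  · rw [ae_restrict_iff' measurableSet_Icc]
    filter_upwards [hd, Measure.ae_ne volume T] with t ht htT htI
    have hslope := (hasDerivAt_iff_tendsto_slope_zero.1 (ht htI).hasDerivAt).comp
      (tendsto_nhdsWithin_iff.2 ⟨hlim, Eventually.of_forall fun n => (hpos n).ne'⟩)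
    refine Tendsto.congr' ?_ (ENNReal.tendsto_ofReal ((hLc.tendsto _).comp hslope))
    have : 0 < T - t := sub_pos.2 (lt_of_le_of_ne htI.2 htT)
    filter_upwards [hlim.eventually_lt_const this] with n hn
    rw [indicator_of_mem (show t ∈ Icc 0 (T - h n) from ⟨htI.1, by linarith⟩)]
    rfl
  · rw [setLIntegral_indicator measurableSet_Icc]
    exact (lintegral_mono_set inter_subset_left).trans (hC _ (hpos n))

lemma LipschitzWith.comp_absolutelyContinuousOnInterval {X Y : Type*} [PseudoMetricSpace X]
    [PseudoMetricSpace Y] {K : NNReal} {φ : X → Y} (hφ : LipschitzWith K φ) {f : ℝ → X}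
    {a b : ℝ} (hf : AbsolutelyContinuousOnInterval f a b) :
    AbsolutelyContinuousOnInterval (φ ∘ f) a b := by
  refine squeeze_zero (fun I => Finset.sum_nonneg fun i _ => dist_nonneg) (fun I => ?_)
    (by simpa using Tendsto.const_mul (K : ℝ) hf)
  rw [Finset.mul_sum]
  exact Finset.sum_le_sum fun i _ => hφ.dist_le_mul _ _

lemma AbsolutelyContinuousOnInterval.integral_deriv_eq_sub_of_finiteDimensional
    [FiniteDimensional ℝ E] {G : ℝ → E} {a b : ℝ} (hG : AbsolutelyContinuousOnInterval G a b)
    (hi : IntervalIntegrable (deriv G) volume a b) :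
    ∫ t in a..b, deriv G t = G b - G a := by
  have : CompleteSpace E := FiniteDimensional.complete ℝ E
  rw [SeparatingDual.eq_iff_forall_dual_eq (R := ℝ)]
  intro ψ
  have hψ := ψ.lipschitz.comp_absolutelyContinuousOnInterval hG
  rw [← ψ.intervalIntegral_comp_comm hi, map_sub]
  refine Eq.trans ?_ hψ.integral_deriv_eq_sub
  refine intervalIntegral.integral_congr_ae ?_
  filter_upwards [hG.boundedVariationOn.ae_differentiableAt_of_mem_uIcc] with t ht htI
  exact (ψ.hasFDerivAt.comp_hasDerivAt t
    (ht (uIoc_subset_uIcc htI)).hasDerivAt).deriv.symm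

/-- A pointwise limit of curves of action at most `s` is again such a curve, with velocity its
almost everywhere defined derivative. -/
lemma isActionCurve_deriv_of_tendsto [FiniteDimensional ℝ E] (hL0 : ∀ ζ, 0 ≤ L ζ)
    (hL : ConvexOn ℝ univ L)
    (hLs : Tendsto (fun ζ : E => L ζ / ‖ζ‖) (comap norm atTop) atTop)
    (hT : 0 ≤ T) (hs : 0 ≤ s) {F w : ℕ → ℝ → E} {G : ℝ → E}
    (hF : ∀ n, IsActionCurve L T s (F n) (w n)) (hFc : ∀ n, Continuous (F n))
    (hG : Continuous G) (hlim : ∀ t, Tendsto (fun n => F n t) atTop (𝓝 (G t))) :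
    IsActionCurve L T s G (deriv G) := by
  have : CompleteSpace E := FiniteDimensional.complete ℝ E
  have hLc : Continuous L := continuousOn_univ.1 (hL.continuousOn isOpen_univ)
  have hAC : AbsolutelyContinuousOnInterval G 0 T := by
    rw [absolutelyContinuousOnInterval_iff]
    intro ε hε
    obtain ⟨R, c, δ, hc, hR, hδ, hlt⟩ := exists_modulus_of_superlinear hL0 hLs hs hε
    refine ⟨δ, hδ, fun I hI hIlt => (le_of_tendsto (tendsto_finsetSum _ fun i _ =>
      (hlim _).dist (hlim _)) (Eventually.of_forall fun n => ?_)).trans_lt (hlt _ hIlt)⟩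
    exact (hF n).sum_dist_le hL0 hLc hT hs hc hR hI
  have hd : ∀ᵐ t, t ∈ Icc 0 T → DifferentiableAt ℝ G t := by
    simpa [uIcc_of_le hT] using hAC.boundedVariationOn.ae_differentiableAt_of_mem_uIcc
  have hle : ∫⁻ t in Icc 0 T, ENNReal.ofReal (L (deriv G t)) ≤ ENNReal.ofReal s := by
    refine lintegral_comp_deriv_le_of_diffQuotient hLc hG hd fun h hh => ?_
    refine lintegral_le_of_tendsto_of_forall_le
      (f := fun n t => ENNReal.ofReal (L (h⁻¹ • (F n (t + h) - F n t)))) (fun n => ?_)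
      (Eventually.of_forall fun t => ?_)
      fun n => (hF n).lintegral_diffQuotient_le hL0 hL hLc hh
    · have := hFc n
      exact (ENNReal.continuous_ofReal.comp (by fun_prop : Continuous fun t =>
        L (h⁻¹ • (F n (t + h) - F n t)))).measurable.aemeasurable
    · exact ENNReal.tendsto_ofReal ((hLc.tendsto _).comp
        (((hlim (t + h)).sub (hlim t)).const_smul h⁻¹))
  have hm := stronglyMeasurable_deriv G
  have hint : IntegrableOn (deriv G) (Icc 0 T) := by
    obtain ⟨R, -, hR⟩ := exists_norm_le_add_mul_of_superlinear hL0 hLs one_pos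
    have hLi : IntegrableOn (fun r => L (deriv G r)) (Icc 0 T) :=
      (lintegral_ofReal_ne_top_iff_integrable
        (hLc.comp_stronglyMeasurable hm).aestronglyMeasurable
        (Eventually.of_forall fun _ => hL0 _)).1 (hle.trans_lt ENNReal.ofReal_lt_top).ne
    exact ((integrable_const R).add (hLi.const_mul 1)).mono' hm.aestronglyMeasurable
      (Eventually.of_forall fun r => hR _)
  refine ⟨hm, hint, fun a ha b hb => ?_, hle⟩
  have hsub : uIcc a b ⊆ Icc 0 T := uIcc_subset_Icc ha hb
  refine ((hAC.mono (by rwa [uIcc_of_le hT])).integral_deriv_eq_sub_of_finiteDimensional ?_).symm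
  exact (intervalIntegrable_iff.2 (hint.mono_set (uIoc_subset_uIcc.trans hsub)))

end ActionCurves

/-- Compact sublevel sets of the action functional: if `L ≥ 0` is convex
and superlinear, then the set of continuous curves `γ : [0,T] → ℝ^d` with `γ(0) = x` which
are absolutely continuous with derivative `v ∈ L¹` and action `∫₀ᵀ L(v) ≤ s` is compact in
`C([0,T]; ℝ^d)` with the supremum norm. -/
theorem stmt15 (d : ℕ) (hd : 1 ≤ d)
    (L : EuclideanSpace ℝ (Fin d) → ℝ)
    (hL_nonneg : ∀ ζ, 0 ≤ L ζ)
    (hL_convex : ConvexOn ℝ Set.univ L)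
    (hL_superlin : Tendsto (fun ζ : EuclideanSpace ℝ (Fin d) => L ζ / ‖ζ‖)
      (comap norm atTop) atTop)
    (T : ℝ) (hT : 0 < T) (x : EuclideanSpace ℝ (Fin d)) (s : ℝ) (hs : 0 ≤ s) :
    IsCompact
      {γ : C(Set.Icc (0 : ℝ) T, EuclideanSpace ℝ (Fin d)) |
        γ ⟨0, by constructor <;> simp [hT.le]⟩ = x ∧
        ∃ v : ℝ → EuclideanSpace ℝ (Fin d),
          IntegrableOn v (Set.Icc 0 T) ∧
          (∀ t : Set.Icc (0 : ℝ) T, γ t = x + ∫ r in Set.Icc 0 (t : ℝ), v r) ∧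
          (∫⁻ r in Set.Icc (0 : ℝ) T, ENNReal.ofReal (L (v r))) ≤ ENNReal.ofReal s} := by
  have hLc : Continuous L := continuousOn_univ.1 (hL_convex.continuousOn isOpen_univ)
  have h0 : (0 : ℝ) ∈ Icc 0 T := ⟨le_rfl, hT.le⟩
  have hset : ∀ γ : C(Icc (0 : ℝ) T, EuclideanSpace ℝ (Fin d)),
      (γ ⟨0, h0⟩ = x ∧ ∃ v : ℝ → EuclideanSpace ℝ (Fin d), IntegrableOn v (Icc 0 T) ∧
        (∀ t : Icc (0 : ℝ) T, γ t = x + ∫ r in Icc 0 (t : ℝ), v r) ∧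
        (∫⁻ r in Icc (0 : ℝ) T, ENNReal.ofReal (L (v r))) ≤ ENNReal.ofReal s) ↔
      γ ⟨0, h0⟩ = x ∧ ∃ w, IsActionCurve L T s (IccExtend hT.le γ) w := by
    intro γ
    refine and_congr_right fun hγ0 => ⟨?_, ?_⟩
    · rintro ⟨v, hvi, hv, hvL⟩
      obtain ⟨w, hwm, hvw⟩ := hvi.aestronglyMeasurable
      have hwi : IntegrableOn w (Icc 0 T) := hvi.congr hvw
      have hw : ∀ t ∈ Icc 0 T, IccExtend hT.le γ t = x + ∫ r in (0 : ℝ)..t, w r := by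
        intro t ht
        rw [IccExtend_of_mem _ _ ht, hv, integral_Icc_eq_integral_Ioc,
          intervalIntegral.integral_of_le ht.1]
        congr 1
        exact integral_congr_ae (ae_restrict_of_ae_restrict_of_subset
          (Ioc_subset_Icc_self.trans (Icc_subset_Icc_right ht.2)) hvw)
      refine ⟨w, hwm, hwi, fun a ha b hb => ?_, ?_⟩
      · have hii : ∀ t ∈ Icc 0 T, IntervalIntegrable w volume 0 t := fun t ht =>
          intervalIntegrable_iff.2 (hwi.mono_set (uIoc_subset_uIcc.trans (uIcc_subset_Icc h0 ht)))
        rw [hw a ha, hw b hb, add_sub_add_left_eq_sub,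
          intervalIntegral.integral_interval_sub_left (hii b hb) (hii a ha)]
      · refine (lintegral_congr_ae ?_).trans_le hvL
        filter_upwards [hvw] with r hr
        rw [hr]
    · rintro ⟨w, hw⟩
      refine ⟨w, hw.integrableOn, fun t => ?_, hw.lintegral_le⟩
      have := hw.sub_eq 0 h0 t t.2
      rw [IccExtend_of_mem _ _ h0, IccExtend_of_mem _ _ t.2, hγ0,
        intervalIntegral.integral_of_le t.2.1, ← integral_Icc_eq_integral_Ioc] at this
      rw [← this]
      abel
  simp_rw [hset]
  set A : Set C(Icc (0 : ℝ) T, EuclideanSpace ℝ (Fin d)) :=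
    {γ | γ ⟨0, h0⟩ = x ∧ ∃ w, IsActionCurve L T s (IccExtend hT.le γ) w}
  have hclosed : IsClosed A := by
    refine isClosed_of_closure_subset fun γ hγ => ?_
    obtain ⟨u, huA, hu⟩ := mem_closure_iff_seq_limit.1 hγ
    have hpt : ∀ t, Tendsto (fun n => u n t) atTop (𝓝 (γ t)) := fun t =>
      ((continuous_eval_const t).tendsto γ).comp hu
    choose w hw using fun n => (huA n).2
    refine ⟨tendsto_nhds_unique (hpt _) ?_, _, isActionCurve_deriv_of_tendsto hL_nonneg
      hL_convex hL_superlin hT.le hs hw (fun n => (u n).continuous.Icc_extend')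
      γ.continuous.Icc_extend' fun t => hpt _⟩
    exact tendsto_const_nhds.congr fun n => (huA n).1.symm
  have hdist : ∀ R c : ℝ, 0 ≤ c → (∀ ζ, ‖ζ‖ ≤ R + c * L ζ) → ∀ γ ∈ A, ∀ a b,
      dist (γ a) (γ b) ≤ R * dist a b + c * s := by
    rintro R c hc hR γ ⟨-, w, hw⟩ a b
    simpa [IccExtend_val, Subtype.dist_eq] using
      hw.dist_le hL_nonneg hLc hT.le hs hc hR a.2 b.2
  let e := ContinuousMap.isometryEquivBoundedOfCompact (Icc (0 : ℝ) T)
    (EuclideanSpace ℝ (Fin d))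
  rw [← e.toHomeomorph.isCompact_image]
  obtain ⟨R, hR0, hR⟩ := exists_norm_le_add_mul_of_superlinear hL_nonneg hL_superlin one_pos
  refine BoundedContinuousFunction.arzela_ascoli₂ (Metric.closedBall x (R * T + 1 * s))
    (isCompact_closedBall _ _) _ (e.toHomeomorph.isClosed_image.2 hclosed) ?_ ?_
  · rintro _ t ⟨γ, hγ, rfl⟩
    have h1 := hdist R 1 zero_le_one hR γ hγ t ⟨0, h0⟩
    rw [hγ.1] at h1
    refine h1.trans ?_
    gcongr
    rw [Subtype.dist_eq, Real.dist_eq, sub_zero, abs_of_nonneg t.2.1]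
    exact t.2.2
  · refine (Metric.uniformEquicontinuous_iff.2 fun ε hε => ?_).equicontinuous
    obtain ⟨R, c, δ, hc, hR, hδ, hlt⟩ :=
      exists_modulus_of_superlinear hL_nonneg hL_superlin hs hε
    refine ⟨δ, hδ, ?_⟩
    rintro a b hab ⟨_, γ, hγ, rfl⟩
    exact (hdist R c hc hR γ hγ a b).trans_lt (hlt _ hab)
end
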